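/- Let 0 → L → M → N → 0 be an exact sequence of (FP)_∞ R-modules. If G̃dim_R L ≤ n and G̃dim_R M ≤ n, then G̃dim_R N ≤ n + 1. In particular, if any two of the three modules have finite restricted G-dimension, so does the third. -/

import Mathlib

open CategoryTheory Opposite TensorProduct

universe u

namespace AB

/-- `M` is `(FP)ₙ`: there is an exact sequence `Fₙ → ⋯ → F₀ → M → 0`
with each `Fᵢ` finitely generated free.  Equivalently (the form used here),
`(FP)₀` means finitely generated, and `M` is `(FP)_{n+1}` iff there is a
surjection from a finitely generated free module whose kernel is `(FP)ₙ`. -/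
def IsFP (R : Type u) [CommRing R] : ℕ → ModuleCat.{u} R → Prop
  | 0, M => Module.Finite R M
  | n + 1, M => ∃ (k : ℕ) (f : (Fin k → R) →ₗ[R] M), Function.Surjective f ∧
      IsFP R n (ModuleCat.of R (LinearMap.ker f))

/-- `M` is `(FP)_∞`. -/
def IsFPInf (R : Type u) [CommRing R] (M : ModuleCat.{u} R) : Prop := ∀ n, IsFP R n M

/-- `Ext^i_R(M, N)` as a type. -/
noncomputable abbrev ext (R : Type u) [CommRing R] (M N : ModuleCat.{u} R) (i : ℕ) :=
  ((Ext R (ModuleCat.{u} R) i).obj (op M)).obj N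

/-- `Ext^i_R(M, N) = 0`. -/
def extZero (R : Type u) [CommRing R] (M N : ModuleCat.{u} R) (i : ℕ) : Prop :=
  Subsingleton (ext R M N i)

/-- membership in the G-class `G(R)`. -/
def MemG (R : Type u) [CommRing R] (M : ModuleCat.{u} R) : Prop :=
  Module.Finite R M ∧ Module.IsReflexive R M ∧
    (∀ i > 0, extZero R M (ModuleCat.of R R) i) ∧
    (∀ i > 0, extZero R (ModuleCat.of R (Module.Dual R M)) (ModuleCat.of R R) i)

/-- membership in the restricted G-class `G̃(R)`. -/
def MemGtilde (R : Type u) [CommRing R] (M : ModuleCat.{u} R) : Prop :=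
  MemG R M ∧ IsFPInf R M ∧ IsFPInf R (ModuleCat.of R (Module.Dual R M))

/-- `Gdim_R M ≤ n`. -/
def GDimLe (R : Type u) [CommRing R] : ℕ → ModuleCat.{u} R → Prop
  | 0, M => MemG R M
  | n + 1, M => ∃ (G : ModuleCat.{u} R) (f : G →ₗ[R] M), MemG R G ∧ Function.Surjective f ∧
      GDimLe R n (ModuleCat.of R (LinearMap.ker f))

/-- `G̃dim_R M ≤ n`. -/
def GtildeDimLe (R : Type u) [CommRing R] : ℕ → ModuleCat.{u} R → Prop
  | 0, M => MemGtilde R M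
  | n + 1, M => ∃ (G : ModuleCat.{u} R) (f : G →ₗ[R] M), MemGtilde R G ∧ Function.Surjective f ∧
      GtildeDimLe R n (ModuleCat.of R (LinearMap.ker f))

/-- `pd_R M ≤ n`. -/
def ProjDimLe (R : Type u) [CommRing R] : ℕ → ModuleCat.{u} R → Prop
  | 0, M => Module.Projective R M
  | n + 1, M => ∃ (P : ModuleCat.{u} R) (f : P →ₗ[R] M), Module.Projective R P ∧
      Function.Surjective f ∧ ProjDimLe R n (ModuleCat.of R (LinearMap.ker f))

/-- The G-dimension of `M`, as an element of `ℕ∞` (`⊤` meaning `Gdim` is infinite/undefined). -/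
noncomputable def GDim (R : Type u) [CommRing R] (M : ModuleCat.{u} R) : ℕ∞ :=
  sInf {n : ℕ∞ | ∃ m : ℕ, n = m ∧ GDimLe R m M}

/-- The restricted G-dimension of `M`, as an element of `ℕ∞`. -/
noncomputable def GtildeDim (R : Type u) [CommRing R] (M : ModuleCat.{u} R) : ℕ∞ :=
  sInf {n : ℕ∞ | ∃ m : ℕ, n = m ∧ GtildeDimLe R m M}

/-- The projective dimension of `M`, as an element of `ℕ∞`. -/
noncomputable def ProjDim (R : Type u) [CommRing R] (M : ModuleCat.{u} R) : ℕ∞ :=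
  sInf {n : ℕ∞ | ∃ m : ℕ, n = m ∧ ProjDimLe R m M}

/-- The classical depth of `N` with respect to the ideal `I`: the supremum of the
lengths of regular sequences on `N` contained in `I`. -/
noncomputable def cdepth (S : Type u) [CommRing S] (I : Ideal S) (N : Type u)
    [AddCommGroup N] [Module S N] : ℕ∞ :=
  ⨆ rs : {l : List S // (∀ r ∈ l, r ∈ I) ∧ RingTheory.Sequence.IsRegular N l},
    (rs.1.length : ℕ∞)

/-- A bundled faithfully flat (commutative) algebra extension of `R`. -/
structure FFExt (R : Type u) [CommRing R] where
  S : Type u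
  [ring : CommRing S]
  [alg : Algebra R S]
  faithfullyFlat : Module.FaithfullyFlat R S

attribute [instance] FFExt.ring FFExt.alg

/-- The depth of a module `M` over a quasi-local ring `R`: the supremum, over all
faithfully flat extensions `S` of `R`, of the classical depth of `M ⊗_R S` with
respect to `mS`. -/
noncomputable def depth (R : Type u) [CommRing R] [IsLocalRing R] (M : Type u)
    [AddCommGroup M] [Module R M] : ℕ∞ :=
  ⨆ E : FFExt R,
    cdepth E.S (Ideal.map (algebraMap R E.S) (IsLocalRing.maximalIdeal R))
      (TensorProduct R E.S M)

end AB

namespace AB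

/-- `0 → A → B → C → 0` is exact. -/
structure IsSES {R A B C : Type*} [CommRing R] [AddCommGroup A] [AddCommGroup B] [AddCommGroup C]
    [Module R A] [Module R B] [Module R C] (f : A →ₗ[R] B) (g : B →ₗ[R] C) : Prop where
  inj : Function.Injective f
  surj : Function.Surjective g
  exact : Function.Exact f g

section Diagrams

variable {R A B C K L P Q : Type*} [CommRing R] [AddCommGroup A] [AddCommGroup B] [AddCommGroup C]
  [AddCommGroup K] [AddCommGroup L] [AddCommGroup P] [AddCommGroup Q]
  [Module R A] [Module R B] [Module R C] [Module R K] [Module R L] [Module R P] [Module R Q]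

theorem isSES_ker {g : B →ₗ[R] C} (hg : Function.Surjective g) :
    IsSES (LinearMap.ker g).subtype g :=
  ⟨Subtype.val_injective, hg, fun x ↦ by simp⟩

theorem IsSES.exists_equiv_ker {f : A →ₗ[R] B} {g : B →ₗ[R] C} (h : IsSES f g) :
    Nonempty (A ≃ₗ[R] LinearMap.ker g) :=
  ⟨(LinearEquiv.ofInjective f h.inj).trans
    (LinearEquiv.ofEq _ _ (LinearMap.exact_iff.mp h.exact).symm)⟩

/-- A short exact sequence `0 → A → B → C → 0` pulls back along `P → B` with kernel `K`. -/
theorem IsSES.exists_comp {f : A →ₗ[R] B} {g : B →ₗ[R] C} (h : IsSES f g)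
    {i : K →ₗ[R] P} {p : P →ₗ[R] B} (hp : IsSES i p) :
    ∃ (W : Submodule R P) (j : K →ₗ[R] W) (q : W →ₗ[R] A),
      IsSES j q ∧ IsSES W.subtype (g ∘ₗ p) := by
  let e := LinearEquiv.ofInjective f h.inj
  have hw (x : LinearMap.ker (g ∘ₗ p)) : p x ∈ LinearMap.range f :=
    (h.exact _).mp x.2
  have hi (x : K) : i x ∈ LinearMap.ker (g ∘ₗ p) := by
    simp [hp.exact.apply_apply_eq_zero]
  let q : LinearMap.ker (g ∘ₗ p) →ₗ[R] A :=
    e.symm.toLinearMap ∘ₗ (p ∘ₗ Submodule.subtype _).codRestrict (LinearMap.range f) hw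
  have hq (x) : f (q x) = p x := congrArg Subtype.val (e.apply_symm_apply _)
  refine ⟨LinearMap.ker (g ∘ₗ p), i.codRestrict _ hi, q, ⟨?_, ?_, ?_⟩,
    isSES_ker (h.surj.comp hp.surj)⟩
  · exact fun x y hxy ↦ hp.inj (congrArg Subtype.val hxy)
  · intro a
    obtain ⟨x, hx⟩ := hp.surj (f a)
    refine ⟨⟨x, by simp [hx, h.exact.apply_apply_eq_zero]⟩, h.inj ?_⟩
    rw [hq, hx]
  · intro x
    rw [← map_eq_zero_iff f h.inj, hq, hp.exact]
    simp [Subtype.ext_iff]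

theorem IsSES.exists_pullback {i : K →ₗ[R] P} {p : P →ₗ[R] C} (hp : IsSES i p)
    {j : L →ₗ[R] Q} {q : Q →ₗ[R] C} (hq : IsSES j q) :
    ∃ (W : Submodule R (P × Q)) (i' : K →ₗ[R] W) (a : W →ₗ[R] Q) (j' : L →ₗ[R] W)
      (b : W →ₗ[R] P), IsSES i' a ∧ IsSES j' b := by
  let W : Submodule R (P × Q) := LinearMap.eqLocus (p ∘ₗ LinearMap.fst R P Q)
    (q ∘ₗ LinearMap.snd R P Q)
  have hW (x : P × Q) : x ∈ W ↔ p x.1 = q x.2 := Iff.rfl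
  refine ⟨W, (LinearMap.inl R P Q ∘ₗ i).codRestrict W ?_, LinearMap.snd R P Q ∘ₗ W.subtype,
    (LinearMap.inr R P Q ∘ₗ j).codRestrict W ?_, LinearMap.fst R P Q ∘ₗ W.subtype,
    ⟨?_, ?_, ?_⟩, ⟨?_, ?_, ?_⟩⟩
  · intro x; simp [hW, hp.exact.apply_apply_eq_zero]
  · intro x; simp [hW, hq.exact.apply_apply_eq_zero]
  · intro x y hxy
    exact hp.inj (congrArg (fun w : W ↦ w.1.1) hxy)
  · intro y
    obtain ⟨x, hx⟩ := hp.surj (q y)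
    exact ⟨⟨(x, y), hx⟩, rfl⟩
  · rintro ⟨⟨x, y⟩, hxy⟩
    rw [hW] at hxy
    refine ⟨?_, ?_⟩
    · rintro rfl
      obtain ⟨k, rfl⟩ := (hp.exact x).mp (by simpa using hxy)
      exact ⟨k, rfl⟩
    · rintro ⟨k, hk⟩
      exact (congrArg (fun w : W ↦ w.1.2) hk).symm
  · intro x y hxy
    exact hq.inj (congrArg (fun w : W ↦ w.1.2) hxy)
  · intro x
    obtain ⟨y, hy⟩ := hq.surj (p x)
    exact ⟨⟨(x, y), hy.symm⟩, rfl⟩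
  · rintro ⟨⟨x, y⟩, hxy⟩
    rw [hW] at hxy
    refine ⟨?_, ?_⟩
    · rintro rfl
      obtain ⟨k, rfl⟩ := (hq.exact y).mp (by simpa using hxy.symm)
      exact ⟨k, rfl⟩
    · rintro ⟨k, hk⟩
      exact (congrArg (fun w : W ↦ w.1.1) hk).symm

theorem IsSES.exists_horseshoe [Module.Projective R Q] {f : A →ₗ[R] B} {g : B →ₗ[R] C}
    (h : IsSES f g) {i : K →ₗ[R] P} {p : P →ₗ[R] A} (hp : IsSES i p)
    {j : L →ₗ[R] Q} {q : Q →ₗ[R] C} (hq : IsSES j q) :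
    ∃ (W : Submodule R (P × Q)) (r : P × Q →ₗ[R] B) (a : K →ₗ[R] W) (b : W →ₗ[R] L),
      IsSES W.subtype r ∧ IsSES a b := by
  obtain ⟨s, hs⟩ := Module.projective_lifting_property g q h.surj
  replace hs (y) : g (s y) = q y := LinearMap.congr_fun hs y
  have hgf := h.exact.apply_apply_eq_zero
  let r : P × Q →ₗ[R] B := (f ∘ₗ p).coprod s
  have hr (x) : r x = f (p x.1) + s x.2 := rfl
  let e := LinearEquiv.ofInjective j hq.inj
  have hk (x : LinearMap.ker r) : x.1.2 ∈ LinearMap.range j := by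
    refine (hq.exact _).mp ?_
    have := congrArg g x.2
    rwa [hr, map_add, hgf, zero_add, hs, map_zero] at this
  let b : LinearMap.ker r →ₗ[R] L :=
    e.symm.toLinearMap ∘ₗ (LinearMap.snd R P Q ∘ₗ Submodule.subtype _).codRestrict
      (LinearMap.range j) hk
  have hb (x) : j (b x) = x.1.2 := congrArg Subtype.val (e.apply_symm_apply _)
  refine ⟨LinearMap.ker r, r, (LinearMap.inl R P Q ∘ₗ i).codRestrict _ ?_, b,
    isSES_ker ?_, ⟨?_, ?_, ?_⟩⟩
  · intro x; simp [hr, hp.exact.apply_apply_eq_zero]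
  · intro y
    obtain ⟨z, hz⟩ := hq.surj (g y)
    obtain ⟨a, ha⟩ := (h.exact (y - s z)).mp (by rw [map_sub, hs, hz, sub_self])
    obtain ⟨x, rfl⟩ := hp.surj a
    exact ⟨(x, z), by rw [hr, ha, sub_add_cancel]⟩
  · intro x y hxy
    exact hp.inj (congrArg (fun w : LinearMap.ker r ↦ w.1.1) hxy)
  · intro l
    obtain ⟨a, ha⟩ := (h.exact (s (j l))).mp (by rw [hs, hq.exact.apply_apply_eq_zero])
    obtain ⟨x, rfl⟩ := hp.surj a
    refine ⟨⟨(-x, j l), ?_⟩, hq.inj (hb _)⟩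
    rw [LinearMap.mem_ker, hr, map_neg, map_neg, ha, neg_add_cancel]
  · intro x
    rw [← map_eq_zero_iff j hq.inj, hb]
    refine ⟨fun hx ↦ ?_, ?_⟩
    · have h0 := x.2
      rw [LinearMap.mem_ker, hr, hx, map_zero, add_zero, map_eq_zero_iff f h.inj, hp.exact] at h0
      obtain ⟨k, hk⟩ := h0
      exact ⟨k, Subtype.ext (Prod.ext hk hx.symm)⟩
    · rintro ⟨k, rfl⟩
      rfl

theorem IsSES.exists_swap_of_projective [Module.Projective R C] {f : A →ₗ[R] B} {g : B →ₗ[R] C}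
    (h : IsSES f g) : ∃ (s : C →ₗ[R] B) (t : B →ₗ[R] A), IsSES s t := by
  obtain ⟨s, hs⟩ := Module.projective_lifting_property g LinearMap.id h.surj
  replace hs (y) : g (s y) = y := LinearMap.congr_fun hs y
  have hgf := h.exact.apply_apply_eq_zero
  let e := LinearEquiv.ofInjective f h.inj
  have hk (x : B) : ((LinearMap.id : B →ₗ[R] B) - s ∘ₗ g) x ∈ LinearMap.range f :=
    (h.exact _).mp (by simp [hs])
  let t : B →ₗ[R] A := e.symm.toLinearMap ∘ₗ ((LinearMap.id : B →ₗ[R] B) - s ∘ₗ g).codRestrict _ hk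
  have ht (x) : f (t x) = x - s (g x) := congrArg Subtype.val (e.apply_symm_apply _)
  refine ⟨s, t, Function.LeftInverse.injective hs, fun a ↦ ⟨f a, h.inj ?_⟩, fun x ↦ ?_⟩
  · rw [ht, hgf, map_zero, sub_zero]
  · rw [← map_eq_zero_iff f h.inj, ht, sub_eq_zero]
    refine ⟨fun hx ↦ ⟨_, hx.symm⟩, ?_⟩
    rintro ⟨c, rfl⟩
    rw [hs]

theorem IsSES.congr_right {f : A →ₗ[R] B} {g : B →ₗ[R] C} (h : IsSES f g) (e : C ≃ₗ[R] K) :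
    IsSES f (e.toLinearMap ∘ₗ g) :=
  ⟨h.inj, e.surjective.comp h.surj, fun x ↦ by simpa using h.exact x⟩

theorem IsSES.congr_mid {f : A →ₗ[R] B} {g : B →ₗ[R] C} (h : IsSES f g) (e : B ≃ₗ[R] K) :
    IsSES (e.toLinearMap ∘ₗ f) (g ∘ₗ e.symm.toLinearMap) :=
  ⟨e.injective.comp h.inj, h.surj.comp e.symm.surjective, fun x ↦ (h.exact _).trans
    ⟨fun ⟨a, ha⟩ ↦ ⟨a, by simp [ha]⟩, fun ⟨a, ha⟩ ↦ ⟨a, by simp [← ha]⟩⟩⟩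

theorem isSES_zero_id.{w} : IsSES (0 : PUnit.{w + 1} →ₗ[R] A) LinearMap.id :=
  ⟨Function.injective_of_subsingleton _, Function.surjective_id, fun x ↦ by simp [eq_comm]⟩

theorem IsSES.finite_mid [Module.Finite R A] [Module.Finite R C] {f : A →ₗ[R] B} {g : B →ₗ[R] C}
    (h : IsSES f g) : Module.Finite R B := by
  obtain ⟨e⟩ := h.exists_equiv_ker
  have : Module.Finite R (LinearMap.ker g) := Module.Finite.equiv e
  have : Module.Finite R (B ⧸ LinearMap.ker g) :=
    Module.Finite.equiv (g.quotKerEquivOfSurjective h.surj).symm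
  exact Module.Finite.of_submodule_quotient (LinearMap.ker g)

end Diagrams

section FP

variable {R : Type u} [CommRing R] {A B C F : Type u} [AddCommGroup A] [AddCommGroup B]
  [AddCommGroup C] [AddCommGroup F] [Module R A] [Module R B] [Module R C] [Module R F]

theorem IsFP.equiv {n : ℕ} (h : IsFP R n (ModuleCat.of R A)) (e : A ≃ₗ[R] B) :
    IsFP R n (ModuleCat.of R B) := by
  induction n generalizing A B with
  | zero =>
    have : Module.Finite R A := h
    exact Module.Finite.equiv e
  | succ n ih =>
    obtain ⟨k, f, hf, hK⟩ := h
    obtain ⟨e'⟩ := ((isSES_ker (g := f) hf).congr_right e).exists_equiv_ker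
    exact ⟨k, e.toLinearMap ∘ₗ f, e.surjective.comp hf, ih hK e'⟩

theorem IsFP.exists_isSES {n : ℕ} (h : IsFP R (n + 1) (ModuleCat.of R A)) :
    ∃ (k : ℕ) (K : Submodule R (Fin k → R)) (p : (Fin k → R) →ₗ[R] A),
      IsSES K.subtype p ∧ IsFP R n (ModuleCat.of R K) := by
  obtain ⟨k, f, hf, hK⟩ := h
  exact ⟨k, LinearMap.ker f, f, isSES_ker hf, hK⟩

theorem IsSES.isFP_succ [Module.Free R B] [Module.Finite R B] {n : ℕ} {f : A →ₗ[R] B}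
    {g : B →ₗ[R] C} (h : IsSES f g) (hA : IsFP R n (ModuleCat.of R A)) :
    IsFP R (n + 1) (ModuleCat.of R C) := by
  let b := (Module.Free.chooseBasis R B).reindex (Fintype.equivFin _)
  have h' := h.congr_mid b.equivFun
  obtain ⟨e⟩ := h'.exists_equiv_ker
  exact ⟨_, _, h'.surj, hA.equiv e⟩

theorem IsSES.isFP_mid {n : ℕ} {f : A →ₗ[R] B} {g : B →ₗ[R] C} (h : IsSES f g)
    (hA : IsFP R n (ModuleCat.of R A)) (hC : IsFP R n (ModuleCat.of R C)) :
    IsFP R n (ModuleCat.of R B) := by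
  induction n generalizing A B C with
  | zero =>
    have : Module.Finite R A := hA
    have : Module.Finite R C := hC
    exact h.finite_mid
  | succ n ih =>
    obtain ⟨k, K, p, hp, hK⟩ := hA.exists_isSES
    obtain ⟨l, L, q, hq, hL⟩ := hC.exists_isSES
    obtain ⟨W, r, a, b, hW, hab⟩ := h.exists_horseshoe hp hq
    exact hW.isFP_succ (ih hab hK hL)

theorem IsSES.isFP_right {n : ℕ} {f : A →ₗ[R] B} {g : B →ₗ[R] C} (h : IsSES f g)
    (hA : IsFP R n (ModuleCat.of R A)) (hB : IsFP R (n + 1) (ModuleCat.of R B)) :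
    IsFP R (n + 1) (ModuleCat.of R C) := by
  obtain ⟨k, K, p, hp, hK⟩ := hB.exists_isSES
  obtain ⟨W, j, q, hjq, hW⟩ := h.exists_comp hp
  exact hW.isFP_succ (hjq.isFP_mid hK hA)

theorem isFP_of_free [Module.Free R F] [Module.Finite R F] (n : ℕ) :
    IsFP R n (ModuleCat.of R F) := by
  induction n generalizing F with
  | zero => exact ‹Module.Finite R F›
  | succ n ih => exact (isSES_zero_id (R := R) (A := F)).isFP_succ ih

theorem IsSES.isFP_left {n : ℕ} {f : A →ₗ[R] B} {g : B →ₗ[R] C} (h : IsSES f g)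
    (hB : IsFP R n (ModuleCat.of R B)) (hC : IsFP R (n + 1) (ModuleCat.of R C)) :
    IsFP R n (ModuleCat.of R A) := by
  obtain ⟨k, K, p, hp, hK⟩ := hC.exists_isSES
  obtain ⟨W, i, a, j, b, hW, hW'⟩ := hp.exists_pullback h
  have hWn := hW.isFP_mid hK hB
  obtain ⟨s, t, hst⟩ := hW'.exists_swap_of_projective
  cases n with
  | zero =>
    have : Module.Finite R W := hWn
    exact Module.Finite.of_surjective t hst.surj
  | succ n => exact hst.isFP_right (isFP_of_free n) hWn

theorem IsFPInf.finite (h : IsFPInf R (ModuleCat.of R A)) : Module.Finite R A := h 0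

theorem IsSES.isFPInf_left {f : A →ₗ[R] B} {g : B →ₗ[R] C} (h : IsSES f g)
    (hB : IsFPInf R (ModuleCat.of R B)) (hC : IsFPInf R (ModuleCat.of R C)) :
    IsFPInf R (ModuleCat.of R A) := fun n ↦ h.isFP_left (hB n) (hC (n + 1))

theorem IsSES.isFPInf_mid {f : A →ₗ[R] B} {g : B →ₗ[R] C} (h : IsSES f g)
    (hA : IsFPInf R (ModuleCat.of R A)) (hC : IsFPInf R (ModuleCat.of R C)) :
    IsFPInf R (ModuleCat.of R B) := fun n ↦ h.isFP_mid (hA n) (hC n)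

theorem IsSES.isFPInf_right {f : A →ₗ[R] B} {g : B →ₗ[R] C} (h : IsSES f g)
    (hA : IsFPInf R (ModuleCat.of R A)) (hB : IsFPInf R (ModuleCat.of R B)) :
    IsFPInf R (ModuleCat.of R C)
  | 0 => by
    have : Module.Finite R B := hB.finite
    exact Module.Finite.of_surjective g h.surj
  | n + 1 => h.isFP_right (hA n) (hB (n + 1))

end FP

section ExtVanishing

open CategoryTheory.Abelian

variable {R : Type u} [CommRing R]

theorem extZero_succ_iff (M N : ModuleCat.{u} R) (n : ℕ) :
    extZero R M N (n + 1) ↔ Subsingleton (Ext.{u} M N (n + 1)) := by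
  let P := ProjectiveResolution.of M
  have e := P.isoExt (R := R) (n + 1) N
  have h₁ : extZero R M N (n + 1) ↔
      ∀ f : P.complex.X (n + 1) ⟶ N, P.complex.d (n + 2) (n + 1) ≫ f = 0 →
        ∃ g : P.complex.X n ⟶ N, P.complex.d (n + 1) n ≫ g = f := by
    have : extZero R M N (n + 1) ↔ (P.complex.linearYonedaObj R N).ExactAt (n + 1) := by
      rw [HomologicalComplex.exactAt_iff_isZero_homology, ← e.isZero_iff,
        ModuleCat.isZero_iff_subsingleton]
      rfl
    rw [this, HomologicalComplex.exactAt_iff' _ n (n + 1) (n + 2) (by simp) (by simp),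
      ShortComplex.moduleCat_exact_iff]
    rfl
  rw [h₁]
  refine ⟨fun h ↦ subsingleton_of_forall_eq 0 fun x ↦ ?_, fun h f hf ↦ ?_⟩
  · obtain ⟨f, hf, rfl⟩ := P.extMk_surjective x (n + 2) rfl
    exact (P.extMk_eq_zero_iff f _ rfl hf n rfl).mpr (h f hf)
  · exact (P.extMk_eq_zero_iff f _ rfl hf n rfl).mp (Subsingleton.elim _ _)

variable {A B C N : Type u} [AddCommGroup A] [AddCommGroup B] [AddCommGroup C] [AddCommGroup N]
  [Module R A] [Module R B] [Module R C] [Module R N] {f : A →ₗ[R] B} {g : B →ₗ[R] C}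

theorem extZero_of_projective [Module.Projective R A] {i : ℕ} (hi : 0 < i) :
    extZero R (ModuleCat.of R A) (ModuleCat.of R N) i := by
  obtain ⟨i, rfl⟩ := Nat.exists_eq_add_of_lt hi
  have : Projective (ModuleCat.of R A) := (IsProjective.iff_projective A).mp inferInstance
  rw [extZero_succ_iff]
  exact Ext.subsingleton_of_projective _ _ _

/-- The short complex of modules attached to a short exact sequence. -/
abbrev IsSES.shortComplex (h : IsSES f g) : ShortComplex (ModuleCat.{u} R) :=
  ShortComplex.mk (ModuleCat.ofHom f) (ModuleCat.ofHom g)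
    (by ext x; exact h.exact.apply_apply_eq_zero x)

theorem IsSES.shortExact (h : IsSES f g) : h.shortComplex.ShortExact :=
  ModuleCat.shortComplex_shortExact _ h.exact h.inj h.surj

theorem IsSES.extZero_mid (h : IsSES f g) {i : ℕ} (hi : 0 < i)
    (hA : extZero R (ModuleCat.of R A) (ModuleCat.of R N) i)
    (hC : extZero R (ModuleCat.of R C) (ModuleCat.of R N) i) :
    extZero R (ModuleCat.of R B) (ModuleCat.of R N) i := by
  obtain ⟨i, rfl⟩ := Nat.exists_eq_succ_of_ne_zero hi.ne'
  rw [extZero_succ_iff] at *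
  refine subsingleton_of_forall_eq 0 fun x ↦ ?_
  obtain ⟨y, rfl⟩ := Ext.contravariant_sequence_exact₂ h.shortExact _ x (hA.elim _ _)
  rw [hC.elim y 0, Ext.comp_zero]

theorem IsSES.extZero_left (h : IsSES f g) {i : ℕ} (hi : 0 < i)
    (hB : extZero R (ModuleCat.of R B) (ModuleCat.of R N) i)
    (hC : extZero R (ModuleCat.of R C) (ModuleCat.of R N) (i + 1)) :
    extZero R (ModuleCat.of R A) (ModuleCat.of R N) i := by
  obtain ⟨i, rfl⟩ := Nat.exists_eq_succ_of_ne_zero hi.ne'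
  rw [extZero_succ_iff] at *
  refine subsingleton_of_forall_eq 0 fun x ↦ ?_
  obtain ⟨y, rfl⟩ := Ext.contravariant_sequence_exact₁ h.shortExact _ x (add_comm _ _)
    (hC.elim _ _)
  rw [hB.elim y 0, Ext.comp_zero]

theorem IsSES.extZero_right (h : IsSES f g) {i : ℕ} (hi : 0 < i)
    (hA : extZero R (ModuleCat.of R A) (ModuleCat.of R N) i)
    (hB : extZero R (ModuleCat.of R B) (ModuleCat.of R N) (i + 1)) :
    extZero R (ModuleCat.of R C) (ModuleCat.of R N) (i + 1) := by
  obtain ⟨i, rfl⟩ := Nat.exists_eq_succ_of_ne_zero hi.ne'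
  rw [extZero_succ_iff] at *
  refine subsingleton_of_forall_eq 0 fun x ↦ ?_
  obtain ⟨y, rfl⟩ := Ext.contravariant_sequence_exact₃ h.shortExact _ x (hB.elim _ _)
    (add_comm 1 (i + 1))
  rw [hA.elim y 0, Ext.comp_zero]

theorem IsSES.exists_extension (h : IsSES f g)
    (hC : extZero R (ModuleCat.of R C) (ModuleCat.of R N) 1) (φ : A →ₗ[R] N) :
    ∃ ψ : B →ₗ[R] N, ψ ∘ₗ f = φ := by
  rw [extZero_succ_iff] at hC
  obtain ⟨y, hy⟩ := Ext.contravariant_sequence_exact₁ h.shortExact (ModuleCat.of R N)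
    (Ext.mk₀ (ModuleCat.ofHom φ)) (n₁ := 1) rfl (hC.elim _ _)
  obtain ⟨ψ, rfl⟩ := Ext.addEquiv₀.symm.surjective y
  refine ⟨ψ.hom, ?_⟩
  have : (ModuleCat.ofHom f) ≫ ψ = ModuleCat.ofHom φ := by
    apply Ext.addEquiv₀.symm.injective
    simpa using hy
  exact congrArg ModuleCat.Hom.hom this

theorem IsSES.extZero_one_right (h : IsSES f g)
    (hB : extZero R (ModuleCat.of R B) (ModuleCat.of R N) 1)
    (hf : ∀ φ : A →ₗ[R] N, ∃ ψ : B →ₗ[R] N, ψ ∘ₗ f = φ) :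
    extZero R (ModuleCat.of R C) (ModuleCat.of R N) 1 := by
  rw [extZero_succ_iff] at *
  refine subsingleton_of_forall_eq 0 fun x ↦ ?_
  obtain ⟨y, rfl⟩ := Ext.contravariant_sequence_exact₃ h.shortExact _ x (hB.elim _ _)
    (add_zero 1)
  obtain ⟨φ, rfl⟩ := Ext.addEquiv₀.symm.surjective y
  obtain ⟨ψ, hψ⟩ := hf φ.hom
  have : φ = h.shortComplex.f ≫ ModuleCat.ofHom ψ := by
    ext x
    exact (LinearMap.congr_fun hψ x).symm
  rw [this]
  simp only [Ext.addEquiv₀_symm_apply, ← Ext.mk₀_comp_mk₀]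
  exact h.shortExact.extClass_comp_assoc _

end ExtVanishing

section Gtilde

variable {R : Type u} [CommRing R] {A B C F : Type u} [AddCommGroup A] [AddCommGroup B]
  [AddCommGroup C] [AddCommGroup F] [Module R A] [Module R B] [Module R C] [Module R F]
  {f : A →ₗ[R] B} {g : B →ₗ[R] C}

theorem IsSES.dual (h : IsSES f g) (hC : extZero R (ModuleCat.of R C) (ModuleCat.of R R) 1) :
    IsSES g.dualMap f.dualMap := by
  refine ⟨LinearMap.dualMap_injective_of_surjective h.surj, h.exists_extension hC, fun φ ↦ ?_⟩
  change φ ∈ LinearMap.ker f.dualMap ↔ φ ∈ LinearMap.range g.dualMap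
  rw [LinearMap.ker_dualMap_eq_dualAnnihilator_range,
    LinearMap.range_dualMap_eq_dualAnnihilator_ker_of_surjective g h.surj,
    LinearMap.exact_iff.mp h.exact]

theorem IsSES.isReflexive_mid [Module.IsReflexive R A] [Module.IsReflexive R C] (h : IsSES f g)
    (h' : IsSES g.dualMap f.dualMap) : Module.IsReflexive R B := by
  have hA := Module.bijective_dual_eval R A
  have hC := Module.bijective_dual_eval R C
  refine ⟨(injective_iff_map_eq_zero _).mpr fun b hb ↦ ?_, fun x ↦ ?_⟩
  · have hb' (ψ : Module.Dual R B) : ψ b = 0 := LinearMap.congr_fun hb ψ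
    have : g b = 0 := hC.1 (by ext φ; simpa using hb' (φ ∘ₗ g))
    obtain ⟨a, rfl⟩ := (h.exact b).mp this
    have : a = 0 := hA.1 <| by
      ext φ
      obtain ⟨ψ, rfl⟩ := h'.surj φ
      simpa using hb' ψ
    rw [this, map_zero]
  · obtain ⟨c, hc⟩ := hC.2 (x ∘ₗ g.dualMap)
    obtain ⟨b, rfl⟩ := h.surj c
    have hx : x - Module.Dual.eval R B b ∈ (LinearMap.ker f.dualMap).dualAnnihilator := by
      rw [Submodule.mem_dualAnnihilator]
      intro ψ hψ
      obtain ⟨φ, rfl⟩ := (h'.exact ψ).mp hψ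
      have := LinearMap.congr_fun hc φ
      simp only [Module.Dual.eval_apply, LinearMap.comp_apply] at this
      simp [← this]
    rw [← LinearMap.range_dualMap_eq_dualAnnihilator_ker_of_surjective _ h'.surj] at hx
    obtain ⟨y, hy⟩ := hx
    obtain ⟨a, rfl⟩ := hA.2 y
    refine ⟨b + f a, ?_⟩
    rw [map_add, ← eq_sub_iff_add_eq', ← hy]
    rfl

theorem IsSES.isReflexive_left [Module.IsReflexive R B] [Module.IsReflexive R C] (h : IsSES f g)
    (h' : IsSES g.dualMap f.dualMap) : Module.IsReflexive R A := by
  have hB := Module.bijective_dual_eval R B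
  have hC := Module.bijective_dual_eval R C
  refine ⟨(injective_iff_map_eq_zero _).mpr fun a ha ↦ ?_, fun y ↦ ?_⟩
  · refine h.inj (hB.1 ?_)
    ext ψ
    simpa using LinearMap.congr_fun ha (ψ ∘ₗ f)
  · obtain ⟨b, hb⟩ := hB.2 (y ∘ₗ f.dualMap)
    have : g b = 0 := hC.1 <| by
      ext φ
      have := LinearMap.congr_fun hb (g.dualMap φ)
      rw [LinearMap.comp_apply, h'.exact.apply_apply_eq_zero, map_zero] at this
      simpa using this
    obtain ⟨a, rfl⟩ := (h.exact b).mp this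
    refine ⟨a, LinearMap.ext fun φ ↦ ?_⟩
    obtain ⟨ψ, rfl⟩ := h'.surj φ
    exact LinearMap.congr_fun hb ψ

theorem memGtilde_of_free [Module.Free R F] [Module.Finite R F] :
    MemGtilde R (ModuleCat.of R F) :=
  ⟨⟨‹_›, inferInstanceAs (Module.IsReflexive R F), fun _ hi ↦ extZero_of_projective hi,
    fun _ hi ↦ extZero_of_projective hi⟩, isFP_of_free, isFP_of_free⟩

theorem IsSES.memGtilde_mid (h : IsSES f g) (hA : MemGtilde R (ModuleCat.of R A))
    (hC : MemGtilde R (ModuleCat.of R C)) : MemGtilde R (ModuleCat.of R B) := by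
  obtain ⟨⟨_, rA, eA, eA'⟩, fA, fA'⟩ := hA
  obtain ⟨⟨_, rC, eC, eC'⟩, fC, fC'⟩ := hC
  have h' := h.dual (eC 1 one_pos)
  have fB := h.isFPInf_mid fA fC
  exact ⟨⟨fB.finite, IsSES.isReflexive_mid h h', fun i hi ↦ h.extZero_mid hi (eA i hi) (eC i hi),
    fun i hi ↦ h'.extZero_mid hi (eC' i hi) (eA' i hi)⟩, fB, h'.isFPInf_mid fC' fA'⟩

theorem IsSES.memGtilde_left (h : IsSES f g) (hB : MemGtilde R (ModuleCat.of R B))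
    (hC : MemGtilde R (ModuleCat.of R C)) : MemGtilde R (ModuleCat.of R A) := by
  obtain ⟨⟨_, rB, eB, eB'⟩, fB, fB'⟩ := hB
  obtain ⟨⟨_, rC, eC, eC'⟩, fC, fC'⟩ := hC
  have h' := h.dual (eC 1 one_pos)
  have fA := h.isFPInf_left fB fC
  refine ⟨⟨fA.finite, IsSES.isReflexive_left h h', fun i hi ↦
    h.extZero_left hi (eB i hi) (eC _ i.succ_pos), fun i hi ↦ ?_⟩, fA, h'.isFPInf_right fC' fB'⟩
  obtain _ | _ | i := i
  · cases hi
  · refine h'.extZero_one_right (eB' 1 hi) fun z ↦ ?_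
    obtain ⟨c, rfl⟩ := (Module.bijective_dual_eval R C).2 z
    obtain ⟨b, rfl⟩ := h.surj c
    exact ⟨Module.Dual.eval R B b, rfl⟩
  · exact h'.extZero_right i.succ_pos (eC' _ i.succ_pos) (eB' _ hi)

theorem MemGtilde.equiv (h : MemGtilde R (ModuleCat.of R A)) (e : A ≃ₗ[R] B) :
    MemGtilde R (ModuleCat.of R B) :=
  (isSES_zero_id.congr_mid e).memGtilde_mid (memGtilde_of_free (F := PUnit.{u + 1})) h

theorem GtildeDimLe.equiv {n : ℕ} (h : GtildeDimLe R n (ModuleCat.of R A)) (e : A ≃ₗ[R] B) :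
    GtildeDimLe R n (ModuleCat.of R B) := by
  induction n generalizing A B with
  | zero => exact MemGtilde.equiv h e
  | succ n ih =>
    obtain ⟨G, p, hG, hp, hK⟩ := h
    obtain ⟨e'⟩ := ((isSES_ker (g := p) hp).congr_right e).exists_equiv_ker
    exact ⟨G, e.toLinearMap ∘ₗ p, hG, e.surjective.comp hp, ih hK e'⟩

theorem IsSES.gtildeDimLe_succ {n : ℕ} (h : IsSES f g) (hA : GtildeDimLe R n (ModuleCat.of R A))
    (hB : MemGtilde R (ModuleCat.of R B)) : GtildeDimLe R (n + 1) (ModuleCat.of R C) := by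
  obtain ⟨e⟩ := h.exists_equiv_ker
  exact ⟨ModuleCat.of R B, g, hB, h.surj, hA.equiv e⟩

theorem GtildeDimLe.exists_isSES {n : ℕ} (h : GtildeDimLe R (n + 1) (ModuleCat.of R A)) :
    ∃ (G : ModuleCat.{u} R) (K : Submodule R G) (p : G →ₗ[R] A), IsSES K.subtype p ∧
      MemGtilde R (ModuleCat.of R G) ∧ GtildeDimLe R n (ModuleCat.of R K) := by
  obtain ⟨G, p, hG, hp, hK⟩ := h
  exact ⟨G, _, p, isSES_ker (g := p) hp, hG, hK⟩

theorem GtildeDimLe.succ {n : ℕ} (h : GtildeDimLe R n (ModuleCat.of R A)) :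
    GtildeDimLe R (n + 1) (ModuleCat.of R A) := by
  induction n generalizing A with
  | zero =>
    exact isSES_zero_id.gtildeDimLe_succ (memGtilde_of_free (F := PUnit.{u + 1})) h
  | succ n ih =>
    obtain ⟨G, K, p, hp, hG, hK⟩ := h.exists_isSES
    exact hp.gtildeDimLe_succ (ih hK) hG

theorem GtildeDimLe.mono {m n : ℕ} (h : GtildeDimLe R m (ModuleCat.of R A)) (hmn : m ≤ n) :
    GtildeDimLe R n (ModuleCat.of R A) := by
  induction hmn with
  | refl => exact h
  | step _ ih => exact ih.succ

theorem GtildeDimLe.finite {n : ℕ} (h : GtildeDimLe R n (ModuleCat.of R A)) :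
    Module.Finite R A := by
  obtain ⟨G, K, p, hp, hG, hK⟩ := h.succ.exists_isSES
  have : Module.Finite R G := hG.1.1
  exact Module.Finite.of_surjective p hp.surj

theorem IsSES.gtildeDimLe_left {n : ℕ} (h : IsSES f g) (hB : GtildeDimLe R n (ModuleCat.of R B))
    (hC : MemGtilde R (ModuleCat.of R C)) : GtildeDimLe R n (ModuleCat.of R A) := by
  cases n with
  | zero => exact h.memGtilde_left hB hC
  | succ n =>
    obtain ⟨G, K, p, hp, hG, hK⟩ := hB.exists_isSES
    obtain ⟨W, j, q, hjq, hW⟩ := h.exists_comp hp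
    exact hjq.gtildeDimLe_succ hK (hW.memGtilde_left hG hC)

theorem IsSES.gtildeDimLe_mid_of_free [Module.Free R C] [Module.Finite R C] {n : ℕ}
    (h : IsSES f g) (hA : GtildeDimLe R n (ModuleCat.of R A)) :
    GtildeDimLe R n (ModuleCat.of R B) := by
  cases n with
  | zero => exact h.memGtilde_mid hA memGtilde_of_free
  | succ n =>
    obtain ⟨G, K, p, hp, hG, hK⟩ := hA.exists_isSES
    obtain ⟨W, r, a, b, hW, hab⟩ := h.exists_horseshoe hp (isSES_zero_id.{u} (R := R) (A := C))
    have hGC : IsSES (LinearMap.inl R G C) (LinearMap.snd R G C) :=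
      ⟨LinearMap.inl_injective, LinearMap.snd_surjective, Function.Exact.inl_snd⟩
    obtain ⟨s, t, hst⟩ := hab.exists_swap_of_projective
    have ht : Function.Injective t := (injective_iff_map_eq_zero t).mpr fun x hx ↦ by
      obtain ⟨y, rfl⟩ := (hst.exact x).mp hx
      rw [Subsingleton.elim y 0, map_zero]
    exact hW.gtildeDimLe_succ (hK.equiv (LinearEquiv.ofBijective t ⟨ht, hst.surj⟩).symm)
      (hGC.memGtilde_mid hG memGtilde_of_free)

theorem IsSES.gtildeDimLe_syzygy [Module.Free R B] [Module.Finite R B] {n : ℕ} (h : IsSES f g)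
    (hC : GtildeDimLe R (n + 1) (ModuleCat.of R C)) : GtildeDimLe R n (ModuleCat.of R A) := by
  obtain ⟨G, K, p, hp, hG, hK⟩ := hC.exists_isSES
  obtain ⟨W, i, a, j, b, hia, hjb⟩ := hp.exists_pullback h
  exact hjb.gtildeDimLe_left (hia.gtildeDimLe_mid_of_free hK) hG

theorem exists_isSES_free (A : Type u) [AddCommGroup A] [Module R A] [Module.Finite R A] :
    ∃ (k : ℕ) (K : Submodule R (Fin k → R)) (p : (Fin k → R) →ₗ[R] A), IsSES K.subtype p := by
  obtain ⟨k, p, hp⟩ := Module.Finite.exists_fin' R A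
  exact ⟨k, _, p, isSES_ker hp⟩

theorem IsSES.gtildeDimLe_right {n : ℕ} (h : IsSES f g) (hA : GtildeDimLe R n (ModuleCat.of R A))
    (hB : GtildeDimLe R n (ModuleCat.of R B)) : GtildeDimLe R (n + 1) (ModuleCat.of R C) := by
  induction n generalizing A B C with
  | zero => exact h.gtildeDimLe_succ hA hB
  | succ n ih =>
    have := hA.finite
    have := hB.finite
    have : Module.Finite R C := Module.Finite.of_surjective g h.surj
    obtain ⟨k, K, p, hp⟩ := exists_isSES_free (R := R) A
    obtain ⟨l, L, q, hq⟩ := exists_isSES_free (R := R) C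
    obtain ⟨W, r, a, b, hW, hab⟩ := h.exists_horseshoe hp hq
    exact hq.gtildeDimLe_succ (ih hab (hp.gtildeDimLe_syzygy hA) (hW.gtildeDimLe_syzygy hB))
      memGtilde_of_free

theorem IsSES.gtildeDimLe_mid {n : ℕ} (h : IsSES f g) (hA : GtildeDimLe R n (ModuleCat.of R A))
    (hC : GtildeDimLe R n (ModuleCat.of R C)) : GtildeDimLe R n (ModuleCat.of R B) := by
  induction n generalizing A B C with
  | zero => exact h.memGtilde_mid hA hC
  | succ n ih =>
    have := hA.finite
    have := hC.finite
    obtain ⟨k, K, p, hp⟩ := exists_isSES_free (R := R) A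
    obtain ⟨l, L, q, hq⟩ := exists_isSES_free (R := R) C
    obtain ⟨W, r, a, b, hW, hab⟩ := h.exists_horseshoe hp hq
    exact hW.gtildeDimLe_succ (ih hab (hp.gtildeDimLe_syzygy hA) (hq.gtildeDimLe_syzygy hC))
      memGtilde_of_free

theorem IsSES.gtildeDimLe_succ_left {n : ℕ} (h : IsSES f g)
    (hB : GtildeDimLe R n (ModuleCat.of R B)) (hC : GtildeDimLe R n (ModuleCat.of R C)) :
    GtildeDimLe R (n + 1) (ModuleCat.of R A) := by
  obtain ⟨G, K, p, hp, hG, hK⟩ := hB.succ.exists_isSES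
  obtain ⟨G', K', p', hp', hG', hK'⟩ := hC.succ.exists_isSES
  obtain ⟨V, j, q, hjq, hV⟩ := h.exists_comp hp
  obtain ⟨W, i, a, i', b, hia, hib⟩ := hV.exists_pullback hp'
  have hWn : GtildeDimLe R n (ModuleCat.of R W) :=
    hib.gtildeDimLe_mid hK' (GtildeDimLe.mono (m := 0) hG n.zero_le)
  exact hjq.gtildeDimLe_right hK (hia.gtildeDimLe_left hWn hG')

theorem gtildeDim_ne_top_iff {M : ModuleCat.{u} R} :
    GtildeDim R M ≠ ⊤ ↔ ∃ n, GtildeDimLe R n M := by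
  simp only [GtildeDim, ne_eq, sInf_eq_top, Set.mem_ofPred_eq, not_forall]
  refine ⟨fun ⟨_, ⟨m, _, hm⟩, _⟩ ↦ ⟨m, hm⟩, fun ⟨m, hm⟩ ↦ ⟨m, ⟨m, rfl, hm⟩, by simp⟩⟩

end Gtilde

end AB

theorem gtildeDim_ses (R : Type u) [CommRing R] (L M N : Type u)
    [AddCommGroup L] [AddCommGroup M] [AddCommGroup N]
    [Module R L] [Module R M] [Module R N]
    (f : L →ₗ[R] M) (g : M →ₗ[R] N)
    (hf : Function.Injective f) (hg : Function.Surjective g)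
    (hfg : LinearMap.range f = LinearMap.ker g)
    (hL : AB.IsFPInf R (ModuleCat.of R L)) (hM : AB.IsFPInf R (ModuleCat.of R M))
    (hN : AB.IsFPInf R (ModuleCat.of R N)) :
    (∀ n : ℕ, AB.GtildeDimLe R n (ModuleCat.of R L) → AB.GtildeDimLe R n (ModuleCat.of R M) →
      AB.GtildeDimLe R (n + 1) (ModuleCat.of R N)) ∧
    (((AB.GtildeDim R (ModuleCat.of R L) ≠ ⊤ ∧ AB.GtildeDim R (ModuleCat.of R M) ≠ ⊤) ∨
      (AB.GtildeDim R (ModuleCat.of R L) ≠ ⊤ ∧ AB.GtildeDim R (ModuleCat.of R N) ≠ ⊤) ∨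
      (AB.GtildeDim R (ModuleCat.of R M) ≠ ⊤ ∧ AB.GtildeDim R (ModuleCat.of R N) ≠ ⊤)) →
      AB.GtildeDim R (ModuleCat.of R L) ≠ ⊤ ∧ AB.GtildeDim R (ModuleCat.of R M) ≠ ⊤ ∧
        AB.GtildeDim R (ModuleCat.of R N) ≠ ⊤) := by
  have h : AB.IsSES f g := ⟨hf, hg, LinearMap.exact_iff.mpr hfg.symm⟩
  refine ⟨fun n ↦ h.gtildeDimLe_right, ?_⟩
  simp only [AB.gtildeDim_ne_top_iff]
  rintro (⟨⟨m, h₁⟩, n, h₂⟩ | ⟨⟨m, h₁⟩, n, h₂⟩ | ⟨⟨m, h₁⟩, n, h₂⟩)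
  all_goals
    replace h₁ := h₁.mono (le_max_left m n)
    replace h₂ := h₂.mono (le_max_right m n)
  · exact ⟨⟨_, h₁⟩, ⟨_, h₂⟩, _, h.gtildeDimLe_right h₁ h₂⟩
  · exact ⟨⟨_, h₁⟩, ⟨_, h.gtildeDimLe_mid h₁ h₂⟩, _, h₂⟩
  · exact ⟨⟨_, h.gtildeDimLe_succ_left h₁ h₂⟩, ⟨_, h₁⟩, _, h₂⟩
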